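/- arXiv:2009.05606 — 2 statements merged into one kernel-verified Lean document; each statement's English description precedes it below -/
import Mathlib

section
/- In the combinatorial setup below, for every n ≥ 1, taking δ = 2^{−n} one has f̄_δ(y_n, y_{n+1}) ≤ λ_{n+1} + n/2^n. -/
open MeasureTheory Filter Set
open scoped ENNReal NNReal

noncomputable section

/-- An `(n,δ)`-match between the sequences `x` and `y`, for the distance function `d`:
an order-preserving bijection `p` from `D` onto `R`, with `D, R ⊆ {0, …, n-1}`, such that
`d (x i) (y (p i)) < δ` for all `i ∈ D`.  The fit size of the match is `D.card`. -/
def IsMatch {X : Type*} (d : X → X → ℝ) (x y : ℕ → X) (n : ℕ) (δ : ℝ)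
    (D R : Finset ℕ) (p : ℕ → ℕ) : Prop :=
  (∀ i ∈ D, i < n) ∧ (∀ j ∈ R, j < n) ∧ Set.BijOn p ↑D ↑R ∧
  (∀ i ∈ D, ∀ j ∈ D, i < j → p i < p j) ∧ (∀ i ∈ D, d (x i) (y (p i)) < δ)

/-- The maximal fit size of an `(n,δ)`-match between `x` and `y`. -/
def maxFit {X : Type*} (d : X → X → ℝ) (x y : ℕ → X) (n : ℕ) (δ : ℝ) : ℕ :=
  sSup {m : ℕ | ∃ D R p, IsMatch d x y n δ D R p ∧ D.card = m}

/-- The `(n,δ)`-gap function `f̄_{n,δ}(x,y)`. -/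
def gapFn {X : Type*} (d : X → X → ℝ) (x y : ℕ → X) (n : ℕ) (δ : ℝ) : ℝ :=
  1 - (maxFit d x y n δ : ℝ) / n

/-- The `f̄_δ`-pseudo-distance: `f̄_δ(x,y) = limsup_n f̄_{n,δ}(x,y)`. -/
def gapDist {X : Type*} (d : X → X → ℝ) (x y : ℕ → X) (δ : ℝ) : ℝ :=
  Filter.limsup (fun n => gapFn d x y n δ) Filter.atTop

/-- The Feldman–Katok pseudometric `F̄_K(x,y) = inf {δ > 0 : f̄_δ(x,y) < δ}`. -/
def FKdist {X : Type*} (d : X → X → ℝ) (x y : ℕ → X) : ℝ :=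
  sInf {δ : ℝ | 0 < δ ∧ gapDist d x y δ < δ}


/-- The standard metric on the shift space `Σ_k = {1,…,k}^ℤ`:
`d(ξ,η) = 2^{-min{|j| : ξ_j ≠ η_j}}` (and `0` if `ξ = η`). -/
def shiftDist {k : ℕ} (ξ η : ℤ → Fin k) : ℝ :=
  haveI := Classical.propDecidable (ξ = η)
  if ξ = η then 0
  else (2 : ℝ) ^ (-((sInf {m : ℕ | ∃ j : ℤ, j.natAbs = m ∧ ξ j ≠ η j} : ℕ) : ℤ))

/-- The `σ`-periodic point of the shift generated by infinite repetition of the word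
`w 0, …, w (π - 1)` (so `w i` is the letter `ω_{i+1}` of the paper). -/
def perPoint {k : ℕ} (π : ℕ) (w : ℕ → Fin k) : ℤ → Fin k :=
  fun j => w (Int.toNat (j % (π : ℤ)))

/-- The `σ`-orbit sequence `(ξ, σξ, σ²ξ, …)` of a point `ξ` of the shift space. -/
def orbitSeq {k : ℕ} (ξ : ℤ → Fin k) : ℕ → (ℤ → Fin k) :=
  fun i j => ξ (j + i)

/-- `λ_n = R_n / (k_n π_{n-1})`. -/
def wordLam (π kseq Rseq : ℕ → ℕ) (n : ℕ) : ℝ :=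
  (Rseq n : ℝ) / ((kseq n : ℝ) * (π (n - 1) : ℝ))

/-- Points of the shift space agreeing on the window `[-n, n]` are at distance less than `2^{-n}`. -/
lemma shiftDist_lt_of_agree {k : ℕ} {ξ η : ℤ → Fin k} {n : ℕ}
    (h : ∀ j : ℤ, j.natAbs ≤ n → ξ j = η j) : shiftDist ξ η < (2 : ℝ) ^ (-(n : ℤ)) := by
  unfold shiftDist
  split_ifs with he
  · positivity
  · obtain ⟨j, hj⟩ := Function.ne_iff.mp he
    obtain ⟨i, hi, hne⟩ := Nat.sInf_mem
      (s := {m : ℕ | ∃ j : ℤ, j.natAbs = m ∧ ξ j ≠ η j}) ⟨_, j, rfl, hj⟩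
    rw [← hi]
    have hlt : n < i.natAbs := not_le.mp fun hle => hne (h i hle)
    exact zpow_lt_zpow_right₀ one_lt_two (by omega)

lemma IsMatch.card_le {X : Type*} {d : X → X → ℝ} {x y : ℕ → X} {n : ℕ} {δ : ℝ}
    {D R : Finset ℕ} {p : ℕ → ℕ} (h : IsMatch d x y n δ D R p) : D.card ≤ n := by
  simpa using Finset.card_le_card (fun i hi => Finset.mem_range.mpr (h.1 i hi) : D ⊆ Finset.range n)

lemma maxFit_le {X : Type*} (d : X → X → ℝ) (x y : ℕ → X) (n : ℕ) (δ : ℝ) :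
    maxFit d x y n δ ≤ n := by
  refine csSup_le' ?_
  rintro m ⟨D, R, p, h, rfl⟩
  exact h.card_le

lemma IsMatch.card_le_maxFit {X : Type*} {d : X → X → ℝ} {x y : ℕ → X} {n : ℕ} {δ : ℝ}
    {D R : Finset ℕ} {p : ℕ → ℕ} (h : IsMatch d x y n δ D R p) : D.card ≤ maxFit d x y n δ := by
  refine le_csSup ⟨n, ?_⟩ ⟨D, R, p, h, rfl⟩
  rintro m ⟨D, R, p, h, rfl⟩
  exact h.card_le

lemma gapFn_nonneg {X : Type*} (d : X → X → ℝ) (x y : ℕ → X) (n : ℕ) (δ : ℝ) :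
    0 ≤ gapFn d x y n δ := by
  have h : (maxFit d x y n δ : ℝ) ≤ n := mod_cast maxFit_le d x y n δ
  have := div_le_one_of_le₀ h (Nat.cast_nonneg n)
  unfold gapFn
  linarith

/-- A lower bound for the fit that is linear up to a bounded error bounds `f̄_δ` from above. -/
lemma gapDist_le_of_linear_le_maxFit {X : Type*} {d : X → X → ℝ} {x y : ℕ → X} {δ a b : ℝ}
    (h : ∀ n : ℕ, a * n - b ≤ maxFit d x y n δ) : gapDist d x y δ ≤ 1 - a := by
  have ht : Tendsto (fun n : ℕ => 1 - a + b / (n : ℝ)) atTop (nhds (1 - a)) := by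
    simpa using (tendsto_const_div_atTop_nhds_zero_nat b).const_add (1 - a)
  rw [← ht.limsup_eq]
  refine limsup_le_limsup ?_ ?_ ht.isBoundedUnder_le
  · filter_upwards [eventually_gt_atTop 0] with n hn
    have hn' : (0 : ℝ) < n := mod_cast hn
    have h1 : (a * n - b) / n ≤ maxFit d x y n δ / n := by gcongr; exact h n
    have h2 : (a * n - b) / n = a - b / n := by field_simp
    unfold gapFn
    linarith
  · exact (isBoundedUnder_of ⟨0, fun n => gapFn_nonneg d x y n δ⟩ :
      IsBoundedUnder (· ≥ ·) atTop fun n => gapFn d x y n δ).isCoboundedUnder_le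

/-- If the first `L = k q` letters of the word `v` of length `P` are `k` copies of the word `u` of
length `q`, then the two periodic points agree on matching windows inside these copies. -/
lemma shiftDist_orbitSeq_lt {k : ℕ} {q L P n m r : ℕ} {u v : ℕ → Fin k}
    (hqL : q ∣ L) (hLP : L ≤ P) (hv : ∀ i < L, v i = u (i % q)) (hr : n ≤ r) (hr' : r + n < L) :
    shiftDist (orbitSeq (perPoint q u) (m * L + r)) (orbitSeq (perPoint P v) (m * P + r))
      < (2 : ℝ) ^ (-(n : ℤ)) := by
  refine shiftDist_lt_of_agree fun j hj => ?_
  obtain ⟨i, hi⟩ : ∃ i : ℕ, j + r = i := Int.eq_ofNat_of_zero_le (by omega)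
  have hiL : i < L := by omega
  obtain ⟨c, rfl⟩ := hqL
  have hu : (j + ((m * (q * c) + r : ℕ) : ℤ)) % (q : ℤ) = ((i % q : ℕ) : ℤ) := by
    have : j + ((m * (q * c) + r : ℕ) : ℤ) = i + q * (m * c) := by
      rw [← hi]; push_cast; ring
    rw [this, Int.add_mul_emod_self_left, Int.natCast_mod]
  have hw : (j + ((m * P + r : ℕ) : ℤ)) % (P : ℤ) = (i : ℤ) := by
    have : j + ((m * P + r : ℕ) : ℤ) = i + P * m := by
      rw [← hi]; push_cast; ring
    rw [this, Int.add_mul_emod_self_left]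
    exact Int.emod_eq_of_lt (by omega) (by omega)
  simp only [orbitSeq, perPoint, hu, hw, Int.toNat_natCast, hv i hiL]

/-- Matching the copies of `u` in each complete period of `v`, up to windows at both ends. -/
lemma div_mul_le_maxFit {k : ℕ} {q L P n : ℕ} {u v : ℕ → Fin k}
    (hqL : q ∣ L) (hLP : L ≤ P) (hv : ∀ i < L, v i = u (i % q)) (N : ℕ) :
    N / P * (L - 2 * n) ≤
      maxFit shiftDist (orbitSeq (perPoint q u)) (orbitSeq (perPoint P v)) N
        ((2 : ℝ) ^ (-(n : ℤ))) := by
  rcases Nat.eq_zero_or_pos L with rfl | hL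
  · simp
  set D : Finset ℕ := {i ∈ Finset.range (N / P * L) | n ≤ i % L ∧ i % L + n < L} with hD
  set p : ℕ → ℕ := fun i => i / L * P + i % L with hp
  have hmono : StrictMono p := by
    intro i j hij
    have hi := Nat.mod_lt i hL
    have hij' : i / L ≤ j / L := Nat.div_le_div_right hij.le
    rcases hij'.eq_or_lt with he | hlt
    · have h1 := Nat.div_add_mod i L
      have h2 := Nat.div_add_mod j L
      simp only [hp]
      rw [he] at h1 ⊢
      omega
    · have := Nat.mul_le_mul_right P (Nat.succ_le_of_lt hlt)
      simp only [hp]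
      rw [Nat.succ_mul] at this
      omega
  have hmem : ∀ i ∈ D, i / L < N / P ∧ n ≤ i % L ∧ i % L + n < L := by
    intro i hi
    rw [hD, Finset.mem_filter, Finset.mem_range] at hi
    exact ⟨(Nat.div_lt_iff_lt_mul hL).mpr hi.1, hi.2⟩
  have hNP : N / P * P ≤ N := Nat.div_mul_le_self N P
  have hmatch : IsMatch shiftDist (orbitSeq (perPoint q u)) (orbitSeq (perPoint P v)) N
      ((2 : ℝ) ^ (-(n : ℤ))) D (D.image p) p := by
    have hpN : ∀ i ∈ D, p i < N := by
      intro i hi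
      have h1 := Nat.mul_le_mul_right P (Nat.succ_le_of_lt (hmem i hi).1)
      have h2 := Nat.mod_lt i hL
      rw [Nat.succ_mul] at h1
      simp only [hp]
      omega
    refine ⟨fun i hi => (hmono.le_apply).trans_lt (hpN i hi), ?_, ?_,
      fun i _ j _ hij => hmono hij, ?_⟩
    · intro j hj
      obtain ⟨i, hi, rfl⟩ := Finset.mem_image.mp hj
      exact hpN i hi
    · rw [Finset.coe_image]
      exact hmono.injective.injOn.bijOn_image
    · intro i hi
      obtain ⟨-, h1, h2⟩ := hmem i hi
      have := shiftDist_orbitSeq_lt (m := i / L) hqL hLP hv h1 h2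
      rwa [Nat.div_add_mod'] at this
  refine le_trans ?_ hmatch.card_le_maxFit
  have hcard : (Finset.range (N / P) ×ˢ Finset.Ico n (L - n)).card = N / P * (L - 2 * n) := by
    rw [Finset.card_product, Finset.card_range, Nat.card_Ico]
    congr 1
    omega
  rw [← hcard]
  have hdm : ∀ m r, r < L → (m * L + r) / L = m ∧ (m * L + r) % L = r := by
    intro m r hr
    rw [mul_comm, Nat.mul_add_div hL, Nat.div_eq_of_lt hr, Nat.mul_add_mod, Nat.mod_eq_of_lt hr]
    simp
  refine Finset.card_le_card_of_injOn (fun a => a.1 * L + a.2) ?_ ?_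
  · rintro ⟨m, r⟩ h
    simp only [Finset.coe_product, Set.mem_prod, Finset.mem_coe, Finset.mem_range,
      Finset.mem_Ico] at h
    obtain ⟨hd, hm⟩ := hdm m r (by omega)
    rw [hD, Finset.mem_coe, Finset.mem_filter, Finset.mem_range,
      ← Nat.div_lt_iff_lt_mul hL, hd, hm]
    omega
  · rintro ⟨m, r⟩ h ⟨m', r'⟩ h' heq
    simp only [Finset.coe_product, Set.mem_prod, Finset.mem_coe, Finset.mem_range,
      Finset.mem_Ico] at h h'
    have h1 := hdm m r (by omega)
    have h2 := hdm m' r' (by omega)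
    simp only at heq
    rw [heq] at h1
    rw [Prod.mk.injEq]
    exact ⟨h1.1.symm.trans h2.1, h1.2.symm.trans h2.2⟩

lemma gapDist_perPoint_le {k : ℕ} {q L P n : ℕ} {u v : ℕ → Fin k} (hP : 0 < P)
    (hqL : q ∣ L) (hLP : L ≤ P) (hv : ∀ i < L, v i = u (i % q)) (hn : 2 * n ≤ L) :
    gapDist shiftDist (orbitSeq (perPoint q u)) (orbitSeq (perPoint P v))
      ((2 : ℝ) ^ (-(n : ℤ))) ≤ 1 - ((L : ℝ) - 2 * n) / P := by
  refine gapDist_le_of_linear_le_maxFit (b := (L : ℝ) - 2 * n) fun N => ?_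
  have h1 : ((N / P * (L - 2 * n) : ℕ) : ℝ) ≤ _ :=
    Nat.cast_le.mpr (div_mul_le_maxFit (n := n) hqL hLP hv N)
  refine le_trans ?_ h1
  have h2 : (0 : ℝ) ≤ (L : ℝ) - 2 * n := sub_nonneg.mpr (mod_cast hn)
  have h3 : (N : ℝ) / P ≤ (N / P : ℕ) + 1 := by
    rw [div_le_iff₀ (mod_cast hP)]
    exact_mod_cast (Nat.lt_mul_of_div_lt (Nat.lt_succ_self (N / P)) hP).le
  push_cast [Nat.cast_sub hn]
  calc ((L : ℝ) - 2 * n) / P * N - (L - 2 * n) = (N / P - 1) * (L - 2 * n) := by ring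
    _ ≤ _ := by gcongr; linarith

/-- In the combinatorial setup, for every `n ≥ 1`, taking `δ = 2^{-n}`
one has `f̄_δ(y_n, y_{n+1}) ≤ λ_{n+1} + n/2^n`. -/
theorem gapDist_succ_le
    {k : ℕ} (π : ℕ → ℕ) (w : ℕ → ℕ → Fin k) (kseq Rseq : ℕ → ℕ)
    (hπ0 : 0 < π 0)
    (hk : ∀ n, 1 ≤ n → 2 ≤ kseq n)
    (hR : ∀ n, 1 ≤ n → 1 ≤ Rseq n)
    (hrec : ∀ n, 1 ≤ n → π n = kseq n * π (n - 1) + Rseq n)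
    (hword : ∀ n, 1 ≤ n → ∀ i < kseq n * π (n - 1), w n i = w (n - 1) (i % π (n - 1))) :
    ∀ n, 1 ≤ n →
      gapDist shiftDist (orbitSeq (perPoint (π n) (w n)))
          (orbitSeq (perPoint (π (n + 1)) (w (n + 1)))) ((2 : ℝ) ^ (-(n : ℤ))) ≤
        wordLam π kseq Rseq (n + 1) + (n : ℝ) / 2 ^ n := by
  have hpow : ∀ n, 2 ^ n ≤ π n := by
    intro n
    induction n with
    | zero => simpa using Nat.succ_le_of_lt hπ0
    | succ n ih =>
      have h1 := hrec (n + 1) (by omega)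
      have h2 := Nat.mul_le_mul (hk (n + 1) (by omega)) ih
      rw [Nat.add_sub_cancel] at h1
      rw [pow_succ']
      omega
  intro n _
  have hrec' := hrec (n + 1) (by omega)
  have hword' := hword (n + 1) (by omega)
  rw [Nat.add_sub_cancel] at hrec' hword'
  have hL : 2 * 2 ^ n ≤ kseq (n + 1) * π n := Nat.mul_le_mul (hk (n + 1) (by omega)) (hpow n)
  have hn2 : n < 2 ^ n := Nat.lt_two_pow_self
  refine (gapDist_perPoint_le (by omega) (Dvd.intro_left _ rfl) (by omega) hword'
    (by omega)).trans ?_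
  simp only [wordLam, Nat.add_sub_cancel]
  rw [hrec', ← Nat.cast_mul]
  generalize kseq (n + 1) * π n = L at *
  generalize Rseq (n + 1) = R at *
  have hLR : (2 * 2 ^ n : ℝ) ≤ L := mod_cast hL
  have hLpos : (0 : ℝ) < L := lt_of_lt_of_le (by positivity) hLR
  have hRnn : (0 : ℝ) ≤ R := Nat.cast_nonneg R
  push_cast
  have h1 : 1 - ((L : ℝ) - 2 * n) / (L + R) = R / (L + R) + 2 * n / (L + R) := by
    field_simp
    ring
  have h2 : (R : ℝ) / (L + R) ≤ R / L := by gcongr; linarith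
  have h3 : 2 * (n : ℝ) / (L + R) ≤ 2 * n / (2 * 2 ^ n) := by gcongr; linarith
  rw [mul_div_mul_left _ _ two_ne_zero] at h3
  linarith

end
end

section
/- For the locally constant skew product T on M = Σ_k × S¹ built from circle homeomorphisms f_1,…,f_k, and for every ξ ∈ Σ_k, there exists ε_0 > 0 such that for every 0 < ε < ε_0 and every n ≥ 1 the fiber π^{-1}(ξ) = {ξ} × S¹ admits an (n,ε)-spanning set of cardinality at most n(⌊1/ε⌋ + 1). -/
open MeasureTheory Filter Set
open scoped ENNReal NNReal

noncomputable section

/-- The two-sided full shift space on `k` symbols. -/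
abbrev Shift (k : ℕ) := ℤ → Fin k

/-- The shift map `σ`. -/
def shiftMap (k : ℕ) : Shift k → Shift k := fun ξ i => ξ (i + 1)

/-- The circle `S¹`, modelled as `ℝ/ℤ`. -/
abbrev Circle1 := AddCircle (1 : ℝ)

/-- The phase space `M = Σ_k × S¹`. -/
abbrev SkewM (k : ℕ) := Shift k × Circle1

/-- The metric `D((ξ,x),(ξ̂,x̂)) = max (d(ξ,ξ̂), d_{S¹}(x,x̂))` on `M = Σ_k × S¹`. -/
def skewDist {k : ℕ} (z z' : SkewM k) : ℝ :=
  max (shiftDist z.1 z'.1) (dist z.2 z'.2)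

/-- A locally constant skew product built from circle homeomorphisms. -/
structure HomeoSetup (k : ℕ) where
  f : Fin k → Circle1 ≃ₜ Circle1

/-- The skew product map `T(ξ,x) = (σξ, f_{ξ₀} x)`. -/
def HomeoSetup.T {k : ℕ} (S : HomeoSetup k) : SkewM k → SkewM k :=
  fun z => (shiftMap k z.1, S.f (z.1 0) z.2)

/-- The fiber `π^{-1}(ξ) = {ξ} × S¹` over a base point `ξ`. -/
def fiber {k : ℕ} (ξ : Shift k) : Set (SkewM k) :=
  {ξ} ×ˢ (Set.univ : Set Circle1)

/-- `F` is an `(n,ε)`-spanning subset of `K` for the skew product `T` (with respect to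
the metric `D`). -/
def IsSpanning {k : ℕ} (S : HomeoSetup k) (K : Set (SkewM k)) (n : ℕ) (ε : ℝ)
    (F : Finset (SkewM k)) : Prop :=
  ↑F ⊆ K ∧ ∀ z ∈ K, ∃ s ∈ F, ∀ i < n, skewDist (S.T^[i] z) (S.T^[i] s) < ε

/-- `r_n(ε, K)`: the minimal cardinality of an `(n,ε)`-spanning subset of `K`. -/
def spanNum {k : ℕ} (S : HomeoSetup k) (K : Set (SkewM k)) (n : ℕ) (ε : ℝ) : ℕ :=
  sInf {m : ℕ | ∃ F : Finset (SkewM k), IsSpanning S K n ε F ∧ F.card = m}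


/-- The points `j / N` for `j < N` on the circle. -/
def gridPoints (N : ℕ) : Finset Circle1 :=
  open Classical in (Finset.range N).image fun j : ℕ => (((j : ℝ) / N : ℝ) : Circle1)

theorem mem_gridPoints {N : ℕ} {y : Circle1} :
    y ∈ gridPoints N ↔ ∃ j < N, (((j : ℝ) / N : ℝ) : Circle1) = y := by
  classical
  simp [gridPoints]

theorem card_gridPoints_le (N : ℕ) : (gridPoints N).card ≤ N := by
  classical
  exact Finset.card_image_le.trans_eq (Finset.card_range N)

/-- An interval of reals of length at least `1 / N` in `[0, 1)` contains some `j / N`. -/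
theorem exists_div_mem_Icc {N : ℕ} (hN : 0 < N) {u v : ℝ} (hu : 0 ≤ u) (hv : v < 1)
    (h : 1 / (N : ℝ) ≤ v - u) : ∃ j < N, (j : ℝ) / N ∈ Icc u v := by
  have hN' : (0 : ℝ) < N := by exact_mod_cast hN
  have hv0 : 0 ≤ v := by
    have : 0 < 1 / (N : ℝ) := by positivity
    linarith
  have hfl : ((⌊v * N⌋₊ : ℕ) : ℝ) ≤ v * N := Nat.floor_le (by positivity)
  have hlt := Nat.lt_floor_add_one (v * N)
  rw [div_le_iff₀ hN'] at h
  refine ⟨⌊v * N⌋₊, ?_, ?_, ?_⟩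
  · have : ((⌊v * N⌋₊ : ℕ) : ℝ) < N := by nlinarith
    exact_mod_cast this
  · rw [le_div_iff₀ hN']
    linarith
  · rwa [div_le_iff₀ hN']

/-- A path on the circle avoiding the grid of mesh `1 / N` on `[a, b)` moves by at most `1 / N`. -/
theorem dist_le_of_avoids_gridPoints {N : ℕ} (hN : 0 < N) {γ : ℝ → Circle1} (hγ : Continuous γ)
    {a b : ℝ} (hab : a < b) (h : ∀ t ∈ Ico a b, γ t ∉ gridPoints N) :
    dist (γ a) (γ b) ≤ 1 / N := by
  have : Fact ((0 : ℝ) < 1) := ⟨one_pos⟩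
  set φ : ℝ → ℝ := fun t => (AddCircle.equivIco 1 0 (γ t) : ℝ)
  have hφγ (t : ℝ) : ((φ t : ℝ) : Circle1) = γ t := (AddCircle.equivIco 1 0).symm_apply_apply (γ t)
  have hφ0 (t : ℝ) : 0 ≤ φ t := (AddCircle.equivIco 1 0 (γ t)).2.1
  have hφ1 (t : ℝ) : φ t < 1 := by simpa using (AddCircle.equivIco 1 0 (γ t)).2.2
  have hcont : ContinuousOn φ (Ico a b) := by
    intro t ht
    have hne : γ t ≠ ((0 : ℝ) : Circle1) := fun h0 =>
      h t ht (mem_gridPoints.2 ⟨0, hN, by simp [h0]⟩)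
    have h1 : ContinuousAt (AddCircle.equivIco (1 : ℝ) 0) (γ t) :=
      AddCircle.continuousAt_equivIco 1 0 hne
    exact (continuous_subtype_val.continuousAt.comp
      (h1.comp hγ.continuousAt)).continuousWithinAt
  have hord : (φ '' Ico a b).OrdConnected := (isPreconnected_Ico.image φ hcont).ordConnected
  have key : ∀ s ∈ Ico a b, ∀ t ∈ Ico a b, φ t - φ s < 1 / N := by
    intro s hs t ht
    by_contra! hle
    obtain ⟨j, hj, hjm⟩ := exists_div_mem_Icc hN (hφ0 s) (hφ1 t) hle
    obtain ⟨r, hr, hrj⟩ := hord.out (mem_image_of_mem φ hs) (mem_image_of_mem φ ht) hjm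
    exact h r hr (mem_gridPoints.2 ⟨j, hj, by rw [← hrj, hφγ]⟩)
  have ha : a ∈ Ico a b := ⟨le_rfl, hab⟩
  have hbound : ∀ t ∈ Ico a b, dist (γ a) (γ t) ≤ 1 / N := by
    intro t ht
    rw [← hφγ a, ← hφγ t, dist_eq_norm, ← AddCircle.coe_sub]
    refine (QuotientAddGroup.norm_mk_le_norm).trans ?_
    rw [Real.norm_eq_abs, abs_le]
    have h1 := key a ha t ht
    have h2 := key t ht a ha
    constructor <;> linarith
  have hclosed : IsClosed {t | dist (γ a) (γ t) ≤ 1 / N} :=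
    isClosed_le (by fun_prop) continuous_const
  have hmem : b ∈ closure (Ico a b) := by
    rw [closure_Ico hab.ne]
    exact ⟨hab.le, le_rfl⟩
  exact closure_minimal (fun t ht => hbound t ht) hclosed hmem

/-- Moving forward along the circle from `a`, one reaches a first point of a nonempty closed set. -/
theorem exists_first_hit {P : Set Circle1} (hP : IsClosed P) (hne : P.Nonempty) (a : ℝ) :
    ∃ b ≥ a, (b : Circle1) ∈ P ∧ ∀ t ∈ Ico a b, (t : Circle1) ∉ P := by
  have : Fact ((0 : ℝ) < 1) := ⟨one_pos⟩
  set Q : Set ℝ := {t | a ≤ t ∧ (t : Circle1) ∈ P}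
  have hQc : IsClosed Q :=
    isClosed_Ici.inter (hP.preimage (AddCircle.continuous_mk' (1 : ℝ)))
  have hQne : Q.Nonempty := by
    obtain ⟨p, hp⟩ := hne
    refine ⟨(AddCircle.equivIco 1 a p : ℝ), (AddCircle.equivIco 1 a p).2.1, ?_⟩
    have : (((AddCircle.equivIco 1 a p : ℝ)) : Circle1) = p :=
      (AddCircle.equivIco 1 a).symm_apply_apply p
    rwa [this]
  have hQb : BddBelow Q := ⟨a, fun t ht => ht.1⟩
  have hmem : sInf Q ∈ Q := hQc.csInf_mem hQne hQb
  exact ⟨sInf Q, hmem.1, hmem.2, fun t ht htP => ht.2.not_ge (csInf_le hQb ⟨ht.1, htP⟩)⟩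

/-- Any `n` circle homeomorphisms admit `n * N` points such that each point of the circle stays
`1 / N`-close to one of them under all of the homeomorphisms. -/
theorem exists_finset_forall_dist_le (g : ℕ → Circle1 ≃ₜ Circle1) {n N : ℕ} (hn : 0 < n)
    (hN : 0 < N) : ∃ P : Finset Circle1, P.card ≤ n * N ∧
      ∀ x, ∃ s ∈ P, ∀ i < n, dist (g i x) (g i s) ≤ 1 / N := by
  classical
  refine ⟨(Finset.range n).biUnion fun i => (gridPoints N).image (g i).symm, ?_, fun x => ?_⟩
  · refine (Finset.card_biUnion_le_card_mul _ _ N fun i _ =>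
      Finset.card_image_le.trans (card_gridPoints_le N)).trans_eq ?_
    rw [Finset.card_range]
  · set P := (Finset.range n).biUnion fun i => (gridPoints N).image (g i).symm
    have hmemP {i : ℕ} (hi : i < n) {y : Circle1} (hy : g i y ∈ gridPoints N) : y ∈ P :=
      Finset.mem_biUnion.2 ⟨i, Finset.mem_range.2 hi,
        Finset.mem_image.2 ⟨g i y, hy, (g i).symm_apply_apply y⟩⟩
    have hne : (P : Set Circle1).Nonempty :=
      ⟨(g 0).symm ((((0 : ℕ) : ℝ) / N : ℝ) : Circle1), hmemP hn (by
        rw [Homeomorph.apply_symm_apply]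
        exact mem_gridPoints.2 ⟨0, hN, rfl⟩)⟩
    obtain ⟨a, rfl⟩ := QuotientAddGroup.mk_surjective x
    obtain ⟨b, hab, hbP, hav⟩ := exists_first_hit P.finite_toSet.isClosed hne a
    refine ⟨(b : Circle1), hbP, fun i hi => ?_⟩
    rcases hab.eq_or_lt with h | h
    · rw [h]
      exact (dist_self _).trans_le (by positivity)
    · exact dist_le_of_avoids_gridPoints hN (γ := fun t : ℝ => g i (t : Circle1))
        ((g i).continuous.comp (AddCircle.continuous_mk' (1 : ℝ))) h
        fun t ht hgt => hav t ht (hmemP hi hgt)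

/-- The fiber homeomorphism `x ↦ (T^i (ξ, x)).2`. -/
def fiberHomeo {k : ℕ} (S : HomeoSetup k) (ξ : Shift k) : ℕ → Circle1 ≃ₜ Circle1
  | 0 => Homeomorph.refl _
  | i + 1 => (fiberHomeo S ξ i).trans (S.f ((shiftMap k)^[i] ξ 0))

theorem iterate_T_eq {k : ℕ} (S : HomeoSetup k) (ξ : Shift k) (x : Circle1) (i : ℕ) :
    S.T^[i] (ξ, x) = ((shiftMap k)^[i] ξ, fiberHomeo S ξ i x) := by
  induction i with
  | zero => rfl
  | succ i ih =>
    rw [Function.iterate_succ_apply', Function.iterate_succ_apply', ih]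
    rfl

theorem skewDist_mk_same {k : ℕ} (ξ : Shift k) (x y : Circle1) :
    skewDist (ξ, x) (ξ, y) = dist x y := by
  simp [skewDist, shiftDist]

/-- For every `ξ ∈ Σ_k` there is `ε₀ > 0` such that for every
`0 < ε < ε₀` and every `n ≥ 1`, the fiber `{ξ} × S¹` admits an `(n,ε)`-spanning set of
cardinality at most `n(⌊1/ε⌋ + 1)`. -/
theorem fiber_spanning_linear_bound {k : ℕ} (S : HomeoSetup k) (ξ : Shift k) :
    ∃ ε₀ : ℝ, 0 < ε₀ ∧ ∀ ε : ℝ, 0 < ε → ε < ε₀ → ∀ n : ℕ, 1 ≤ n →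
      ∃ F : Finset (SkewM k), IsSpanning S (fiber ξ) n ε F ∧
        F.card ≤ n * (⌊1 / ε⌋₊ + 1) := by
  classical
  refine ⟨1, one_pos, fun ε hε _ n hn => ?_⟩
  obtain ⟨P, hcard, hP⟩ := exists_finset_forall_dist_le (fiberHomeo S ξ) hn
    (Nat.succ_pos ⌊1 / ε⌋₊)
  refine ⟨P.image fun x => (ξ, x), ⟨?_, ?_⟩, Finset.card_image_le.trans hcard⟩
  · intro z hz
    obtain ⟨x, _, rfl⟩ := Finset.mem_image.1 (Finset.mem_coe.1 hz)
    exact ⟨rfl, mem_univ _⟩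
  · rintro ⟨η, x⟩ ⟨hη, _⟩
    obtain rfl : η = ξ := hη
    obtain ⟨s, hs, hd⟩ := hP x
    refine ⟨(η, s), Finset.mem_image_of_mem _ hs, fun i hi => ?_⟩
    rw [iterate_T_eq, iterate_T_eq, skewDist_mk_same]
    refine (hd i hi).trans_lt ?_
    rw [one_div_lt (by positivity) hε, Nat.cast_succ]
    exact Nat.lt_floor_add_one (1 / ε)

end
end
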